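/- Let G be an n-player polynomial game over a compact basic semialgebraic set X ⊆ ℝ^m whose quadratic module Q(X) is Archimedean, with symmetrized Jacobian SJ(x). Then G is strictly monotone (i.e., SJ(x) is negative definite for every x ∈ X) if and only if there exist a finite level ℓ ∈ ℕ and λ < 0 such that the polynomial (x,y) ↦ λ − yᵀ SJ(x) y belongs to Q_ℓ(X × B). -/

import Mathlib

open MvPolynomial Finset

noncomputable section

/-- `p` is a sum of squares of polynomials. -/
def IsSOS {σ : Type*} (p : MvPolynomial σ ℝ) : Prop :=
  ∃ (k : ℕ) (q : Fin k → MvPolynomial σ ℝ), p = ∑ i, q i ^ 2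

/-- Membership in the quadratic module generated by the inequality polynomials `g`
and the equality polynomials `h`. -/
def InQM {σ ιg ιh : Type*} [Fintype ιg] [Fintype ιh]
    (g : ιg → MvPolynomial σ ℝ) (h : ιh → MvPolynomial σ ℝ)
    (p : MvPolynomial σ ℝ) : Prop :=
  ∃ (s0 : MvPolynomial σ ℝ) (s : ιg → MvPolynomial σ ℝ) (q : ιh → MvPolynomial σ ℝ),
    IsSOS s0 ∧ (∀ j, IsSOS (s j)) ∧
      p = s0 + ∑ j, g j * s j + ∑ j, h j * q j

/-- Membership in the degree-`ℓ` truncation of the quadratic module: all the SOS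
multipliers and the polynomial multipliers have degree at most `ℓ`. -/
def InQMdeg {σ ιg ιh : Type*} [Fintype ιg] [Fintype ιh]
    (ℓ : ℕ) (g : ιg → MvPolynomial σ ℝ) (h : ιh → MvPolynomial σ ℝ)
    (p : MvPolynomial σ ℝ) : Prop :=
  ∃ (s0 : MvPolynomial σ ℝ) (s : ιg → MvPolynomial σ ℝ) (q : ιh → MvPolynomial σ ℝ),
    IsSOS s0 ∧ (∀ j, IsSOS (s j)) ∧
      s0.totalDegree ≤ ℓ ∧ (∀ j, (s j).totalDegree ≤ ℓ) ∧ (∀ j, (q j).totalDegree ≤ ℓ) ∧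
      p = s0 + ∑ j, g j * s j + ∑ j, h j * q j

/-- The basic semialgebraic set `{x | g j x ≥ 0 for all j, h j x = 0 for all j}`. -/
def semialgSet {m : ℕ} {ιg ιh : Type*} (g : ιg → MvPolynomial (Fin m) ℝ)
    (h : ιh → MvPolynomial (Fin m) ℝ) : Set (Fin m → ℝ) :=
  {x | (∀ j, 0 ≤ eval x (g j)) ∧ ∀ j, eval x (h j) = 0}
/-- The `j`-th component of the pseudogradient of the game with payoffs `u`, where the
variable `j` belongs to player `π j`. -/
def pseudoGrad {m n : ℕ} (π : Fin m → Fin n) (u : Fin n → MvPolynomial (Fin m) ℝ)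
    (j : Fin m) : MvPolynomial (Fin m) ℝ :=
  pderiv j (u (π j))

/-- Entry `(j, k)` of the symmetrized Jacobian `SJ = (J + Jᵀ)/2` of the pseudogradient. -/
def sjac {m n : ℕ} (π : Fin m → Fin n) (u : Fin n → MvPolynomial (Fin m) ℝ)
    (j k : Fin m) : MvPolynomial (Fin m) ℝ :=
  C (1 / 2 : ℝ) * (pderiv k (pseudoGrad π u j) + pderiv j (pseudoGrad π u k))

/-- The quadratic form `yᵀ SJ(x) y` of the symmetrized Jacobian. -/
def sjForm {m n : ℕ} (π : Fin m → Fin n) (u : Fin n → MvPolynomial (Fin m) ℝ)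
    (x y : Fin m → ℝ) : ℝ :=
  ∑ j, ∑ k, y j * y k * eval x (sjac π u j k)
/-- The inequality polynomials of `X`, viewed as polynomials in the variables `(x, y)`. -/
def liftIneq {m : ℕ} {ιg : Type*} (τ : Type*) (g : ιg → MvPolynomial (Fin m) ℝ) :
    ιg → MvPolynomial (Fin m ⊕ τ) ℝ :=
  fun j => rename Sum.inl (g j)

/-- The equality polynomials of `X` together with `1 - yᵀy`, viewed as polynomials in the
variables `(x, y)`; together with `liftIneq` these define `X × B`. -/
def liftEq {m : ℕ} {ιh : Type*} (τ : Type*) [Fintype τ] (h : ιh → MvPolynomial (Fin m) ℝ) :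
    ιh ⊕ Unit → MvPolynomial (Fin m ⊕ τ) ℝ :=
  Sum.elim (fun j => rename Sum.inl (h j)) (fun _ => 1 - ∑ t : τ, X (Sum.inr t) ^ 2)

/-- The polynomial `yᵀ SJ(x) y` in the variables `(x, y)`. -/
def sjFormPoly {m n : ℕ} (π : Fin m → Fin n) (u : Fin n → MvPolynomial (Fin m) ℝ) :
    MvPolynomial (Fin m ⊕ Fin m) ℝ :=
  ∑ j, ∑ k, X (Sum.inr j) * X (Sum.inr k) * rename Sum.inl (sjac π u j k)

/-- A quadratic module of a commutative ring: a subset containing `1`, closed under addition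
and under multiplication by squares. -/
structure IsQuadraticModule {A : Type*} [CommRing A] (Q : Set A) : Prop where
  one_mem : 1 ∈ Q
  add_mem : ∀ {a b}, a ∈ Q → b ∈ Q → a + b ∈ Q
  sq_mul_mem : ∀ (a) {b}, b ∈ Q → a ^ 2 * b ∈ Q

namespace IsQuadraticModule

section Ring

variable {A : Type*} [CommRing A] {Q : Set A}

lemma zero_mem (hQ : IsQuadraticModule Q) : 0 ∈ Q := by
  simpa using hQ.sq_mul_mem 0 hQ.one_mem

lemma sq_mem (hQ : IsQuadraticModule Q) (a : A) : a ^ 2 ∈ Q := by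
  simpa using hQ.sq_mul_mem a hQ.one_mem

lemma sum_mem (hQ : IsQuadraticModule Q) {ι : Type*} (s : Finset ι) {f : ι → A}
    (hf : ∀ i ∈ s, f i ∈ Q) : ∑ i ∈ s, f i ∈ Q := by
  classical
  induction s using Finset.induction_on with
  | empty => simpa using hQ.zero_mem
  | insert i s hi ih =>
    rw [Finset.sum_insert hi]
    exact hQ.add_mem (hf i (by simp)) (ih fun j hj => hf j (by simp [hj]))

lemma isSumSq_mul_mem (hQ : IsQuadraticModule Q) {s q : A} (hs : IsSumSq s) (hq : q ∈ Q) :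
    s * q ∈ Q := by
  induction hs with
  | zero => simpa using hQ.zero_mem
  | sq_add a _ ih =>
    rw [add_mul, ← sq]
    exact hQ.add_mem (hQ.sq_mul_mem a hq) ih

/-- The quadratic module obtained by adjoining one element. -/
lemma adjoin (hQ : IsQuadraticModule Q) (a : A) :
    IsQuadraticModule {x | ∃ q ∈ Q, ∃ s, IsSumSq s ∧ x = q + s * a} where
  one_mem := ⟨1, hQ.one_mem, 0, .zero, by simp⟩
  add_mem := by
    rintro _ _ ⟨q, hq, s, hs, rfl⟩ ⟨q', hq', s', hs', rfl⟩
    exact ⟨q + q', hQ.add_mem hq hq', s + s', hs.add hs', by ring⟩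
  sq_mul_mem := by
    rintro b _ ⟨q, hq, s, hs, rfl⟩
    exact ⟨b ^ 2 * q, hQ.sq_mul_mem b hq, b ^ 2 * s,
      ((IsSquare.sq b).isSumSq).mul hs, by ring⟩

/-- A proper quadratic module is contained in a maximal proper one. -/
lemma exists_maximal (hQ : IsQuadraticModule Q) (hneg : (-1 : A) ∉ Q) :
    ∃ M, Q ⊆ M ∧ Maximal (fun M => IsQuadraticModule M ∧ (-1 : A) ∉ M) M := by
  refine zorn_subset_nonempty {M | IsQuadraticModule M ∧ (-1 : A) ∉ M} ?_ Q ⟨hQ, hneg⟩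
  intro c hc hchain hne
  refine ⟨⋃₀ c, ⟨⟨?_, ?_, ?_⟩, ?_⟩, fun s hs => Set.subset_sUnion_of_mem hs⟩
  · obtain ⟨M, hM⟩ := hne
    exact ⟨M, hM, (hc hM).1.one_mem⟩
  · rintro a b ⟨M, hM, ha⟩ ⟨M', hM', hb⟩
    rcases hchain.total hM hM' with h | h
    · exact ⟨M', hM', (hc hM').1.add_mem (h ha) hb⟩
    · exact ⟨M, hM, (hc hM).1.add_mem ha (h hb)⟩
  · rintro a b ⟨M, hM, hb⟩
    exact ⟨M, hM, (hc hM).1.sq_mul_mem a hb⟩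
  · rintro ⟨M, hM, h⟩
    exact (hc hM).2 h

end Ring

section Algebra

variable {A : Type*} [CommRing A] [Algebra ℝ A] {Q : Set A}

local notation "κ" => algebraMap ℝ A

lemma algebraMap_mul_mem (hQ : IsQuadraticModule Q) {r : ℝ} (hr : 0 ≤ r) {a : A} (ha : a ∈ Q) :
    κ r * a ∈ Q := by
  have h := hQ.sq_mul_mem (κ (Real.sqrt r)) ha
  rwa [← map_pow, Real.sq_sqrt hr] at h

lemma algebraMap_mem (hQ : IsQuadraticModule Q) {r : ℝ} (hr : 0 ≤ r) : κ r ∈ Q := by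
  simpa using hQ.algebraMap_mul_mem hr hQ.one_mem

/-- The support `Q ∩ -Q` of a quadratic module is closed under multiplication. -/
lemma mul_mem_of_mem_of_neg_mem (hQ : IsQuadraticModule Q) {s : A} (hs : s ∈ Q) (hs' : -s ∈ Q)
    (a : A) : a * s ∈ Q := by
  have h := hQ.algebraMap_mul_mem (r := 1 / 4) (by norm_num)
    (hQ.add_mem (hQ.sq_mul_mem (a + 1) hs) (hQ.sq_mul_mem (a - 1) hs'))
  have e : κ (1 / 4) * ((a + 1) ^ 2 * s + (a - 1) ^ 2 * -s) = κ (1 / 4 * 4) * (a * s) := by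
    rw [map_mul, map_ofNat]; ring
  rw [e] at h
  norm_num at h
  exact h

lemma mem_or_neg_mem_of_maximal
    (hM : Maximal (fun M => IsQuadraticModule M ∧ (-1 : A) ∉ M) Q) (a : A) :
    a ∈ Q ∨ -a ∈ Q := by
  obtain ⟨hQ, hneg⟩ := hM.prop
  have key : ∀ b, b ∉ Q → ∃ q ∈ Q, ∃ s, IsSumSq s ∧ (-1 : A) = q + s * b := by
    intro b hb
    by_contra hcon
    have hle := hM.le_of_ge (y := {x | ∃ q ∈ Q, ∃ s, IsSumSq s ∧ x = q + s * b})
      ⟨hQ.adjoin b, hcon⟩ (fun x hx => ⟨x, hx, 0, .zero, by simp⟩)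
    exact hb (hle ⟨0, hQ.zero_mem, 1, .one, by simp⟩)
  by_contra! hcon
  obtain ⟨q₁, hq₁, s₁, hs₁, e₁⟩ := key a hcon.1
  obtain ⟨q₂, hq₂, s₂, hs₂, e₂⟩ := key (-a) hcon.2
  have h1 : s₁ ∈ Q := by simpa using hQ.isSumSq_mul_mem hs₁ hQ.one_mem
  have h2 : s₂ ∈ Q := by simpa using hQ.isSumSq_mul_mem hs₂ hQ.one_mem
  have h3 : -s₁ ∈ Q := by
    have e : -s₁ = s₂ + (s₁ * q₂ + s₂ * q₁) := by linear_combination s₂ * e₁ + s₁ * e₂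
    rw [e]
    exact hQ.add_mem h2 (hQ.add_mem (hQ.isSumSq_mul_mem hs₁ hq₂) (hQ.isSumSq_mul_mem hs₂ hq₁))
  refine hneg ?_
  rw [e₁, mul_comm]
  exact hQ.add_mem hq₁ (hQ.mul_mem_of_mem_of_neg_mem h1 h3 a)

/-- A quadratic module is Archimedean if every square is bounded above by a constant. -/
def IsArchimedean (Q : Set A) : Prop :=
  ∀ a : A, ∃ r : ℝ, 0 ≤ r ∧ κ r - a ^ 2 ∈ Q

lemma IsArchimedean.exists_sub_mem (hQ : IsQuadraticModule Q) (hA : IsArchimedean Q) (a : A) :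
    ∃ r : ℝ, 0 ≤ r ∧ ∀ t, r ≤ t → κ t - a ∈ Q := by
  obtain ⟨r, hr, h⟩ := hA a
  refine ⟨r + 1 / 4, by positivity, fun t ht => ?_⟩
  have h' := hQ.add_mem (hQ.add_mem h (hQ.sq_mem (a - κ (1 / 2))))
    (hQ.algebraMap_mem (sub_nonneg.2 ht))
  have e : κ r - a ^ 2 + (a - κ (1 / 2)) ^ 2 + κ (t - (r + 1 / 4)) = κ t - a := by
    have e1 : κ (1 / 4) = κ (1 / 2) ^ 2 := by rw [← map_pow]; norm_num
    have e2 : 2 * κ (1 / 2) = 1 := by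
      rw [← map_ofNat κ 2, ← map_mul]; norm_num
    rw [map_sub, map_add, e1]
    linear_combination -a * e2
  rwa [e] at h'

lemma nonneg_of_algebraMap_mem (hQ : IsQuadraticModule Q) (hneg : (-1 : A) ∉ Q) {r : ℝ}
    (h : κ r ∈ Q) : 0 ≤ r := by
  by_contra! hr
  refine hneg ?_
  have h' := hQ.algebraMap_mul_mem (r := (-r)⁻¹) (by simpa using hr.le) h
  rw [← map_mul] at h'
  have e : (-r)⁻¹ * r = -1 := by rw [inv_neg, neg_mul, inv_mul_cancel₀ hr.ne]
  rwa [e, map_neg, map_one] at h'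

/-- `r` is the value of `a` determined by `Q`. -/
def IsValue (Q : Set A) (a : A) (r : ℝ) : Prop :=
  ∀ ε : ℝ, 0 < ε → a - κ r + κ ε ∈ Q ∧ κ r - a + κ ε ∈ Q

lemma IsValue.unique (hQ : IsQuadraticModule Q) (hneg : (-1 : A) ∉ Q) {a : A} {r s : ℝ}
    (hr : IsValue Q a r) (hs : IsValue Q a s) : r = s := by
  have key : ∀ {r s : ℝ}, IsValue Q a r → IsValue Q a s → r ≤ s := by
    intro r s hr hs
    refine le_of_forall_pos_le_add fun ε hε => ?_
    have h := hQ.add_mem (hr (ε / 2) (by positivity)).1 (hs (ε / 2) (by positivity)).2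
    have e : a - κ r + κ (ε / 2) + (κ s - a + κ (ε / 2)) = κ (s + ε - r) := by
      rw [map_sub, map_add, ← add_halves ε, map_add, add_halves]; ring
    rw [e] at h
    linarith [hQ.nonneg_of_algebraMap_mem hneg h]
  exact le_antisymm (key hr hs) (key hs hr)

lemma IsValue.of_algebraMap (hQ : IsQuadraticModule Q) (r : ℝ) : IsValue Q (κ r) r := by
  intro ε hε
  simpa using hQ.algebraMap_mem hε.le

lemma IsValue.add (hQ : IsQuadraticModule Q) {a b : A} {r s : ℝ}
    (hr : IsValue Q a r) (hs : IsValue Q b s) : IsValue Q (a + b) (r + s) := by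
  intro ε hε
  obtain ⟨h1, h2⟩ := hr (ε / 2) (by positivity)
  obtain ⟨h3, h4⟩ := hs (ε / 2) (by positivity)
  have e : κ ε = κ (ε / 2) + κ (ε / 2) := by rw [← map_add, add_halves]
  constructor
  · convert hQ.add_mem h1 h3 using 1
    rw [map_add, e]; ring
  · convert hQ.add_mem h2 h4 using 1
    rw [map_add, e]; ring

lemma IsValue.algebraMap_mul (hQ : IsQuadraticModule Q) {a : A} {r : ℝ}
    (hr : IsValue Q a r) (t : ℝ) : IsValue Q (κ t * a) (t * r) := by
  intro ε hε
  rcases lt_trichotomy t 0 with ht | rfl | ht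
  · obtain ⟨h1, h2⟩ := hr (ε / -t) (div_pos hε (by linarith))
    have e : κ ε = κ (-t) * κ (ε / -t) := by
      rw [← map_mul, mul_div_cancel₀ ε (neg_ne_zero.2 ht.ne)]
    constructor
    · convert hQ.algebraMap_mul_mem (r := -t) (by linarith) h2 using 1
      rw [e, map_mul, map_neg]; ring
    · convert hQ.algebraMap_mul_mem (r := -t) (by linarith) h1 using 1
      rw [e, map_mul, map_neg]; ring
  · simpa using hQ.algebraMap_mem hε.le
  · obtain ⟨h1, h2⟩ := hr (ε / t) (div_pos hε ht)
    have e : κ ε = κ t * κ (ε / t) := by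
      rw [← map_mul]; congr 1; field_simp
    constructor
    · convert hQ.algebraMap_mul_mem ht.le h1 using 1
      rw [e, map_mul]; ring
    · convert hQ.algebraMap_mul_mem ht.le h2 using 1
      rw [e, map_mul]; ring

lemma IsValue.sq_of_zero (hQ : IsQuadraticModule Q) {a : A} (ha : IsValue Q a 0) :
    IsValue Q (a ^ 2) 0 := by
  intro ε hε
  refine ⟨by simpa using hQ.add_mem (hQ.sq_mem a) (hQ.algebraMap_mem hε.le), ?_⟩
  obtain ⟨δ, hδ, rfl⟩ : ∃ δ : ℝ, 0 < δ ∧ ε = δ ^ 2 :=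
    ⟨Real.sqrt ε, Real.sqrt_pos.2 hε, (Real.sq_sqrt hε.le).symm⟩
  obtain ⟨h1, h2⟩ := ha δ hδ
  have h := hQ.algebraMap_mul_mem (r := (2 * δ)⁻¹) (by positivity)
    (hQ.add_mem (hQ.sq_mul_mem (κ δ + a) h2) (hQ.sq_mul_mem (κ δ - a) h1))
  convert h using 1
  have e : κ ((2 * δ)⁻¹) * (2 * κ δ) = 1 := by
    rw [← map_ofNat κ 2, ← map_mul, ← map_mul, inv_mul_cancel₀ (by positivity), map_one]
  rw [map_zero, map_pow]
  linear_combination -(κ δ ^ 2 - a ^ 2) * e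

lemma IsValue.sq (hQ : IsQuadraticModule Q) {a : A} {r : ℝ} (ha : IsValue Q a r) :
    IsValue Q (a ^ 2) (r ^ 2) := by
  have h0 : IsValue Q (a + κ (-r)) 0 := by
    simpa using ha.add hQ (IsValue.of_algebraMap hQ (-r))
  have h := ((h0.sq_of_zero hQ).add hQ (ha.algebraMap_mul hQ (2 * r))).add hQ
    (IsValue.of_algebraMap hQ (-r ^ 2))
  convert h using 1
  · simp only [map_neg, map_mul, map_pow, map_ofNat]; ring
  · ring

lemma IsValue.mul (hQ : IsQuadraticModule Q) {a b : A} {r s : ℝ}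
    (ha : IsValue Q a r) (hb : IsValue Q b s) : IsValue Q (a * b) (r * s) := by
  have h := ((((ha.add hQ hb).sq hQ).add hQ ((ha.sq hQ).algebraMap_mul hQ (-1))).add hQ
    ((hb.sq hQ).algebraMap_mul hQ (-1))).algebraMap_mul hQ (1 / 2)
  have e2 : κ (1 / 2) * 2 = 1 := by
    rw [← map_ofNat κ 2, ← map_mul]; norm_num
  convert h using 1
  · simp only [map_neg, map_one]
    linear_combination -(a * b) * e2
  · ring

lemma exists_isValue (hQ : IsQuadraticModule Q) (hneg : (-1 : A) ∉ Q)
    (htot : ∀ a : A, a ∈ Q ∨ -a ∈ Q) (hA : IsArchimedean Q) (a : A) :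
    ∃ r, IsValue Q a r := by
  set S : Set ℝ := {r | a - κ r ∈ Q} with hS
  obtain ⟨r₁, -, h₁⟩ := hA.exists_sub_mem hQ a
  obtain ⟨r₂, -, h₂⟩ := hA.exists_sub_mem hQ (-a)
  have hne : S.Nonempty := ⟨-r₂, by simpa [hS, add_comm] using h₂ r₂ le_rfl⟩
  have hbdd : BddAbove S := by
    refine ⟨r₁, fun r hr => ?_⟩
    have h := hQ.add_mem (h₁ r₁ le_rfl) hr
    have e : κ r₁ - a + (a - κ r) = κ (r₁ - r) := by rw [map_sub]; ring
    rw [e] at h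
    linarith [hQ.nonneg_of_algebraMap_mem hneg h]
  refine ⟨sSup S, fun ε hε => ⟨?_, ?_⟩⟩
  · obtain ⟨r, hr, hlt⟩ := exists_lt_of_lt_csSup hne (sub_lt_self (sSup S) hε)
    convert hQ.add_mem hr (hQ.algebraMap_mem (r := r - (sSup S - ε)) (by linarith)) using 1
    simp only [map_sub]; ring
  · have hnot : sSup S + ε ∉ S := fun h => by linarith [le_csSup hbdd h]
    convert (htot (a - κ (sSup S + ε))).resolve_left hnot using 1
    rw [map_add]; ring

/-- A proper Archimedean quadratic module is nonnegative under some real character. -/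
lemma exists_algHom_nonneg (hQ : IsQuadraticModule Q) (hneg : (-1 : A) ∉ Q)
    (hA : IsArchimedean Q) : ∃ φ : A →ₐ[ℝ] ℝ, ∀ a ∈ Q, 0 ≤ φ a := by
  obtain ⟨M, hQM, hmax⟩ := hQ.exists_maximal hneg
  obtain ⟨hM, hMneg⟩ := hmax.prop
  have hMA : IsArchimedean M := fun a => (hA a).imp fun r hr => ⟨hr.1, hQM hr.2⟩
  choose φ hφ using hM.exists_isValue hMneg (mem_or_neg_mem_of_maximal hmax) hMA
  have huniq {a : A} {r : ℝ} (h : IsValue M a r) : φ a = r := (hφ a).unique hM hMneg h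
  have hconst (r : ℝ) : φ (κ r) = r := huniq (.of_algebraMap hM r)
  refine ⟨{ toFun := φ
            map_one' := by simpa using hconst 1
            map_zero' := by simpa using hconst 0
            map_mul' := fun a b => huniq ((hφ a).mul hM (hφ b))
            map_add' := fun a b => huniq ((hφ a).add hM (hφ b))
            commutes' := hconst }, fun a ha => ?_⟩
  change 0 ≤ φ a
  refine le_of_forall_pos_le_add fun ε hε => ?_
  have h := hM.add_mem (hφ a ε hε).2 (hQM ha)
  have e : κ (φ a) - a + κ ε + a = κ (φ a + ε) := by rw [map_add]; ring
  rw [e] at h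
  exact hM.nonneg_of_algebraMap_mem hMneg h

lemma mem_of_isSumSq_mul_sub_one_mem (hQ : IsQuadraticModule Q) (hA : IsArchimedean Q)
    {s f : A} (hs : IsSumSq s) (hsf : s * f - 1 ∈ Q) : f ∈ Q := by
  obtain ⟨k₁, hk₁, h₁⟩ := hA.exists_sub_mem hQ s
  obtain ⟨k₂, hk₂, h₂⟩ := hA.exists_sub_mem hQ (1 + s ^ 2 * f)
  obtain ⟨r₀, hr₀, h₀⟩ := hA.exists_sub_mem hQ (-f)
  obtain ⟨k, hk, hk1, hk2⟩ : ∃ k : ℝ, 0 < k ∧ k₁ ≤ 2 * k ∧ k₂ ≤ 2 * k :=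
    ⟨k₁ + k₂ + 1, by positivity, by linarith, by linarith⟩
  have step : ∀ r : ℝ, 0 ≤ r → f + κ r ∈ Q → f + κ (r - (k ^ 2)⁻¹) ∈ Q := by
    intro r hr hfr
    have h := hQ.algebraMap_mul_mem (r := (k ^ 2)⁻¹) (by positivity)
      (hQ.add_mem (hQ.add_mem (hQ.add_mem (hQ.sq_mul_mem (κ k - s) hfr)
        (hQ.algebraMap_mul_mem (r := 2 * k) (by positivity) hsf))
        (hQ.algebraMap_mul_mem hr (hQ.isSumSq_mul_mem hs (h₁ _ hk1)))) (h₂ _ hk2))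
    convert h using 1
    have e : κ ((k ^ 2)⁻¹) * κ k ^ 2 = 1 := by
      rw [← map_pow, ← map_mul, inv_mul_cancel₀ (by positivity), map_one]
    simp only [map_sub, map_mul, map_ofNat]
    linear_combination -(f + κ r) * e
  have descend : ∀ (n : ℕ) (r : ℝ), r ≤ n * (k ^ 2)⁻¹ → f + κ r ∈ Q → f ∈ Q := by
    have mono : ∀ r : ℝ, r ≤ 0 → f + κ r ∈ Q → f ∈ Q := fun r hr h => by
      simpa [add_assoc, ← map_add] using
        hQ.add_mem h (hQ.algebraMap_mem (r := -r) (by linarith))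
    intro n
    induction n with
    | zero => exact fun r hr h => mono r (by simpa using hr) h
    | succ n ih =>
      intro r hr h
      rcases le_total r 0 with hr0 | hr0
      · exact mono r hr0 h
      · refine ih _ ?_ (step r hr0 h)
        push_cast at hr
        linarith
  obtain ⟨n, hn⟩ := exists_nat_ge (r₀ * k ^ 2)
  refine descend n r₀ ?_ (by simpa [add_comm] using h₀ r₀ le_rfl)
  rw [← div_eq_mul_inv, le_div_iff₀ (by positivity)]
  exact hn

/-- An element positive under all real characters that are nonnegative on an Archimedean
quadratic module belongs to it. -/
theorem mem_of_forall_algHom_pos (hQ : IsQuadraticModule Q) (hA : IsArchimedean Q) {f : A}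
    (hf : ∀ φ : A →ₐ[ℝ] ℝ, (∀ a ∈ Q, 0 ≤ φ a) → 0 < φ f) : f ∈ Q := by
  have hsub : Q ⊆ {x | ∃ q ∈ Q, ∃ s, IsSumSq s ∧ x = q + s * -f} :=
    fun x hx => ⟨x, hx, 0, .zero, by simp⟩
  by_cases hneg : (-1 : A) ∈ {x | ∃ q ∈ Q, ∃ s, IsSumSq s ∧ x = q + s * -f}
  · obtain ⟨q, hq, s, hs, e⟩ := hneg
    refine hQ.mem_of_isSumSq_mul_sub_one_mem hA hs ?_
    have e' : s * f - 1 = q := by linear_combination e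
    rwa [e']
  · obtain ⟨φ, hφ⟩ := (hQ.adjoin (-f)).exists_algHom_nonneg hneg
      fun a => (hA a).imp fun r hr => ⟨hr.1, hsub hr.2⟩
    have h1 := hf φ fun a ha => hφ a (hsub ha)
    have h2 := hφ (-f) ⟨0, hQ.zero_mem, 1, .one, by simp⟩
    rw [map_neg] at h2
    linarith

end Algebra

lemma isArchimedean_of_sub_sum_sq_mem {σ : Type*} [Fintype σ] {Q : Set (MvPolynomial σ ℝ)}
    (hQ : IsQuadraticModule Q) {N : ℝ} (hN : 0 ≤ N) (h : C N - ∑ i, X i ^ 2 ∈ Q) :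
    IsArchimedean Q := by
  classical
  have hmul : ∀ a b : MvPolynomial σ ℝ, (∃ r : ℝ, 0 ≤ r ∧ C r - a ^ 2 ∈ Q) →
      (∃ r : ℝ, 0 ≤ r ∧ C r - b ^ 2 ∈ Q) → ∃ r : ℝ, 0 ≤ r ∧ C r - (a * b) ^ 2 ∈ Q := by
    rintro a b ⟨r, hr, ha⟩ ⟨s, hs, hb⟩
    refine ⟨r * s, by positivity, ?_⟩
    convert hQ.add_mem (hQ.algebraMap_mul_mem hr hb) (hQ.sq_mul_mem b ha) using 1
    rw [algebraMap_eq, C_mul]; ring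
  intro p
  change ∃ r : ℝ, 0 ≤ r ∧ C r - p ^ 2 ∈ Q
  induction p using MvPolynomial.induction_on with
  | C a => exact ⟨a ^ 2, by positivity, by simpa using hQ.zero_mem⟩
  | add p q hp hq =>
    obtain ⟨r, hr, hp⟩ := hp
    obtain ⟨s, hs, hq⟩ := hq
    refine ⟨2 * r + 2 * s, by positivity, ?_⟩
    convert hQ.add_mem (hQ.add_mem (hQ.add_mem hp hp) (hQ.add_mem hq hq)) (hQ.sq_mem (p - q))
      using 1
    simp only [C_add, C_mul, map_ofNat]; ring
  | mul_X p i hp =>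
    refine hmul p (X i) hp ⟨N, hN, ?_⟩
    convert hQ.add_mem h (hQ.sum_mem (univ.erase i) (f := fun j => X j ^ 2)
      fun j _ => hQ.sq_mem (X j)) using 1
    rw [← Finset.add_sum_erase univ _ (mem_univ i)]; ring

end IsQuadraticModule

lemma isSOS_iff_isSumSq {σ : Type*} {p : MvPolynomial σ ℝ} : IsSOS p ↔ IsSumSq p := by
  constructor
  · rintro ⟨k, q, rfl⟩
    exact IsSumSq.sum fun i _ => (IsSquare.sq (q i)).isSumSq
  · intro hp
    induction hp with
    | zero => exact ⟨0, Fin.elim0, by simp⟩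
    | sq_add a _ ih =>
      obtain ⟨k, q, rfl⟩ := ih
      exact ⟨k + 1, Fin.cons a q, by simp [Fin.sum_univ_succ, sq]⟩

lemma IsSOS.rename {σ τ : Type*} (f : σ → τ) {p : MvPolynomial σ ℝ} (hp : IsSOS p) :
    IsSOS (MvPolynomial.rename f p) := by
  obtain ⟨k, q, rfl⟩ := hp
  exact ⟨k, fun i => MvPolynomial.rename f (q i), by simp⟩

lemma IsSOS.eval_nonneg {σ : Type*} {p : MvPolynomial σ ℝ} (hp : IsSOS p) (x : σ → ℝ) :
    0 ≤ eval x p := by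
  obtain ⟨k, q, rfl⟩ := hp
  rw [map_sum]
  exact Finset.sum_nonneg fun i _ => by rw [map_pow]; positivity

section InQM

variable {σ ιg ιh : Type*} [Fintype ιg] [Fintype ιh]
  {g : ιg → MvPolynomial σ ℝ} {h : ιh → MvPolynomial σ ℝ} {p : MvPolynomial σ ℝ}

lemma isQuadraticModule_setOf_inQM : IsQuadraticModule {p | InQM g h p} where
  one_mem := ⟨1, 0, 0, isSOS_iff_isSumSq.2 .one, fun _ => isSOS_iff_isSumSq.2 .zero, by simp⟩
  add_mem := by
    rintro _ _ ⟨s₀, s, q, h₀, hs, rfl⟩ ⟨t₀, t, r, k₀, ht, rfl⟩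
    simp only [isSOS_iff_isSumSq] at h₀ hs k₀ ht
    refine ⟨s₀ + t₀, s + t, q + r, isSOS_iff_isSumSq.2 (h₀.add k₀),
      fun j => isSOS_iff_isSumSq.2 ((hs j).add (ht j)), ?_⟩
    simp only [Pi.add_apply, mul_add, Finset.sum_add_distrib]
    ring
  sq_mul_mem := by
    rintro a _ ⟨s₀, s, q, h₀, hs, rfl⟩
    simp only [isSOS_iff_isSumSq] at h₀ hs
    have ha : IsSumSq (a ^ 2) := (IsSquare.sq a).isSumSq
    refine ⟨a ^ 2 * s₀, fun j => a ^ 2 * s j, fun j => a ^ 2 * q j,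
      isSOS_iff_isSumSq.2 (ha.mul h₀), fun j => isSOS_iff_isSumSq.2 (ha.mul (hs j)), ?_⟩
    simp only [mul_add, Finset.mul_sum, mul_left_comm]

lemma inQM_ineq (j : ιg) : InQM g h (g j) := by
  classical
  refine ⟨0, Pi.single j 1, 0, isSOS_iff_isSumSq.2 .zero, fun i => isSOS_iff_isSumSq.2 ?_, ?_⟩
  · rcases eq_or_ne i j with rfl | hij
    · simp
    · simp [hij]
  · simp [Pi.single_apply]

lemma inQM_eq_mul (j : ιh) (q : MvPolynomial σ ℝ) : InQM g h (h j * q) := by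
  classical
  refine ⟨0, 0, Pi.single j q, isSOS_iff_isSumSq.2 .zero,
    fun i => isSOS_iff_isSumSq.2 .zero, ?_⟩
  simp [Pi.single_apply]

lemma InQM.exists_inQMdeg (hp : InQM g h p) : ∃ ℓ, InQMdeg ℓ g h p := by
  obtain ⟨s₀, s, q, h₀, hs, e⟩ := hp
  refine ⟨s₀.totalDegree + univ.sup (fun j => (s j).totalDegree) +
    univ.sup (fun j => (q j).totalDegree), s₀, s, q, h₀, hs, by omega, fun j => ?_,
    fun j => ?_, e⟩
  · have := Finset.le_sup (f := fun j => (s j).totalDegree) (mem_univ j)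
    omega
  · have := Finset.le_sup (f := fun j => (q j).totalDegree) (mem_univ j)
    omega

lemma InQMdeg.inQM {ℓ : ℕ} (hp : InQMdeg ℓ g h p) : InQM g h p := by
  obtain ⟨s₀, s, q, h₀, hs, -, -, -, e⟩ := hp
  exact ⟨s₀, s, q, h₀, hs, e⟩

lemma InQM.eval_nonneg (hp : InQM g h p) {x : σ → ℝ} (hg : ∀ j, 0 ≤ eval x (g j))
    (hh : ∀ j, eval x (h j) = 0) : 0 ≤ eval x p := by
  obtain ⟨s₀, s, q, h₀, hs, rfl⟩ := hp
  simp only [map_add, map_sum, map_mul, hh, zero_mul, Finset.sum_const_zero, add_zero]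
  exact add_nonneg (h₀.eval_nonneg x)
    (Finset.sum_nonneg fun j _ => mul_nonneg (hg j) ((hs j).eval_nonneg x))

/-- **Putinar's Positivstellensatz**: a polynomial that is positive on a basic semialgebraic
set with Archimedean quadratic module belongs to the quadratic module. -/
theorem inQM_of_forall_eval_pos [Fintype σ] {N : ℝ} (hN : 0 ≤ N)
    (hA : InQM g h (C N - ∑ i, X i ^ 2))
    (hp : ∀ x : σ → ℝ, (∀ j, 0 ≤ eval x (g j)) → (∀ j, eval x (h j) = 0) → 0 < eval x p) :
    InQM g h p := by
  have hQ : IsQuadraticModule {p | InQM g h p} := isQuadraticModule_setOf_inQM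
  refine hQ.mem_of_forall_algHom_pos (hQ.isArchimedean_of_sub_sum_sq_mem hN hA) fun φ hφ => ?_
  have heval : ∀ a, φ a = eval (fun i => φ (X i)) a := fun a => by
    have e : φ = aeval fun i => φ (X i) := MvPolynomial.algHom_ext (by simp)
    rw [← coe_aeval_eq_eval]
    exact DFunLike.congr_fun e a
  rw [heval]
  refine hp _ (fun j => ?_) fun j => le_antisymm ?_ ?_
  · rw [← heval]
    exact hφ _ (inQM_ineq j)
  · have := hφ _ (inQM_eq_mul j (-1))
    rw [heval] at this
    simpa using this
  · have := hφ _ (inQM_eq_mul j 1)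
    rw [heval] at this
    simpa using this

end InQM

lemma InQM.rename_inl {m : ℕ} {ιg ιh τ : Type*} [Fintype ιg] [Fintype ιh] [Fintype τ]
    {g : ιg → MvPolynomial (Fin m) ℝ} {h : ιh → MvPolynomial (Fin m) ℝ}
    {p : MvPolynomial (Fin m) ℝ} (hp : InQM g h p) :
    InQM (liftIneq τ g) (liftEq τ h) (rename Sum.inl p) := by
  obtain ⟨s₀, s, q, h₀, hs, rfl⟩ := hp
  refine ⟨rename Sum.inl s₀, fun j => rename Sum.inl (s j),
    Sum.elim (fun j => rename Sum.inl (q j)) 0, h₀.rename _, fun j => (hs j).rename _, ?_⟩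
  simp [liftIneq, liftEq]

lemma inQM_lift_sub_sum_sq {m : ℕ} {ιg ιh τ : Type*} [Fintype ιg] [Fintype ιh] [Fintype τ]
    {g : ιg → MvPolynomial (Fin m) ℝ} {h : ιh → MvPolynomial (Fin m) ℝ} {N : ℝ}
    (hA : InQM g h (C N - ∑ i, X i ^ 2)) :
    InQM (liftIneq τ g) (liftEq τ h) (C (N + 1) - ∑ i, X i ^ 2) := by
  have h1 := isQuadraticModule_setOf_inQM.add_mem (hA.rename_inl (τ := τ))
    (inQM_eq_mul (g := liftIneq τ g) (h := liftEq τ h) (Sum.inr ()) 1)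
  convert Set.mem_ofPred_eq ▸ h1 using 1
  simp [liftEq]
  ring

lemma eval_sjFormPoly {m n : ℕ} (π : Fin m → Fin n) (u : Fin n → MvPolynomial (Fin m) ℝ)
    (z : Fin m ⊕ Fin m → ℝ) :
    eval z (sjFormPoly π u) = sjForm π u (z ∘ Sum.inl) (z ∘ Sum.inr) := by
  simp [sjFormPoly, sjForm, eval_rename]

lemma sjForm_smul {m n : ℕ} (π : Fin m → Fin n) (u : Fin n → MvPolynomial (Fin m) ℝ)
    (x y : Fin m → ℝ) (c : ℝ) : sjForm π u x (c • y) = c ^ 2 * sjForm π u x y := by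
  simp only [sjForm, Finset.mul_sum, Pi.smul_apply, smul_eq_mul]
  exact Finset.sum_congr rfl fun j _ => Finset.sum_congr rfl fun k _ => by ring

lemma continuous_sjForm {m n : ℕ} (π : Fin m → Fin n) (u : Fin n → MvPolynomial (Fin m) ℝ) :
    Continuous fun p : (Fin m → ℝ) × (Fin m → ℝ) => sjForm π u p.1 p.2 := by
  unfold sjForm
  refine continuous_finsetSum _ fun j _ => continuous_finsetSum _ fun k _ => ?_
  exact (by fun_prop : Continuous fun p : (Fin m → ℝ) × (Fin m → ℝ) => p.2 j * p.2 k).mul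
    ((MvPolynomial.continuous_eval _).comp continuous_fst)

lemma isCompact_setOf_sum_sq_eq_one {ι : Type*} [Fintype ι] :
    IsCompact {y : ι → ℝ | ∑ i, y i ^ 2 = 1} := by
  refine (isCompact_univ_pi fun _ : ι => isCompact_Icc (a := (-1 : ℝ)) (b := 1)).of_isClosed_subset
    (isClosed_eq (by fun_prop) continuous_const) fun y hy i _ => ?_
  rw [Set.mem_Icc, ← abs_le, ← sq_le_one_iff_abs_le_one]
  exact (Finset.single_le_sum (f := fun i => y i ^ 2) (fun j _ => sq_nonneg _)
    (mem_univ i)).trans_eq hy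

/-- If the form is negative on a compact set times the sphere, it is bounded away from zero. -/
lemma exists_neg_forall_sjForm_lt {m n : ℕ} (π : Fin m → Fin n)
    (u : Fin n → MvPolynomial (Fin m) ℝ) {K : Set (Fin m → ℝ)} (hK : IsCompact K)
    (hneg : ∀ x ∈ K, ∀ y : Fin m → ℝ, y ≠ 0 → sjForm π u x y < 0) :
    ∃ lam : ℝ, lam < 0 ∧
      ∀ x ∈ K, ∀ y : Fin m → ℝ, ∑ i, y i ^ 2 = 1 → sjForm π u x y < lam := by
  have hne0 : ∀ y : Fin m → ℝ, ∑ i, y i ^ 2 = 1 → y ≠ 0 := by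
    rintro y hy rfl
    simp at hy
  rcases (K ×ˢ {y : Fin m → ℝ | ∑ i, y i ^ 2 = 1}).eq_empty_or_nonempty with hem | hne
  · exact ⟨-1, by norm_num, fun x hx y hy => (hem.subset (Set.mk_mem_prod hx hy)).elim⟩
  · obtain ⟨⟨x₀, y₀⟩, ⟨hx₀, hy₀⟩, hmax⟩ := (hK.prod isCompact_setOf_sum_sq_eq_one).exists_isMaxOn
      hne (continuous_sjForm π u).continuousOn
    have h0 : sjForm π u x₀ y₀ < 0 := hneg x₀ hx₀ y₀ (hne0 y₀ hy₀)
    refine ⟨sjForm π u x₀ y₀ / 2, by linarith, fun x hx y hy => ?_⟩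
    have : sjForm π u x y ≤ sjForm π u x₀ y₀ := hmax (Set.mk_mem_prod hx hy)
    linarith

/-- For a polynomial game over a compact basic semialgebraic set `X` with
Archimedean quadratic module, the game is strictly monotone (`SJ(x)` negative definite for
every `x ∈ X`) if and only if some finite level `ℓ` of the SOS hierarchy certifies it:
`λ - yᵀ SJ(x) y ∈ Q_ℓ(X × B)` for some `λ < 0`. -/
theorem strictly_monotone_iff_finite_sos_certificate {m n mg mh : ℕ}
    (π : Fin m → Fin n) (u : Fin n → MvPolynomial (Fin m) ℝ)
    (g : Fin mg → MvPolynomial (Fin m) ℝ) (h : Fin mh → MvPolynomial (Fin m) ℝ)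
    (hX : IsCompact (semialgSet g h))
    (hArch : ∃ N : ℕ, InQM g h (C (N : ℝ) - ∑ i, X i ^ 2)) :
    (∀ x ∈ semialgSet g h, ∀ y : Fin m → ℝ, y ≠ 0 → sjForm π u x y < 0) ↔
      ∃ (ℓ : ℕ) (lam : ℝ), lam < 0 ∧
        InQMdeg ℓ (liftIneq (Fin m) g) (liftEq (Fin m) h) (C lam - sjFormPoly π u) := by
  constructor
  · intro hneg
    obtain ⟨N, hN⟩ := hArch
    obtain ⟨lam, hlam, hlt⟩ := exists_neg_forall_sjForm_lt π u hX hneg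
    have hmem : InQM (liftIneq (Fin m) g) (liftEq (Fin m) h) (C lam - sjFormPoly π u) := by
      refine inQM_of_forall_eval_pos (by positivity) (inQM_lift_sub_sum_sq hN)
        fun z hg hh => ?_
      rw [map_sub, eval_C, eval_sjFormPoly, sub_pos]
      refine hlt _ ⟨fun j => ?_, fun j => ?_⟩ _ ?_
      · simpa [liftIneq, eval_rename] using hg j
      · simpa [liftEq, eval_rename] using hh (Sum.inl j)
      · have := hh (Sum.inr ())
        simp only [liftEq, Sum.elim_inr, map_sub, map_one, map_sum, map_pow, eval_X] at this
        simpa using (sub_eq_zero.1 this).symm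
    obtain ⟨ℓ, hℓ⟩ := hmem.exists_inQMdeg
    exact ⟨ℓ, lam, hlam, hℓ⟩
  · rintro ⟨ℓ, lam, hlam, hmem⟩ x ⟨hg, hh⟩ y hy
    set S : ℝ := ∑ i, y i ^ 2 with hS
    have hSpos : 0 < S := by
      obtain ⟨i, hi⟩ := Function.ne_iff.1 hy
      exact Finset.sum_pos' (fun _ _ => sq_nonneg _) ⟨i, mem_univ i, sq_pos_of_ne_zero hi⟩
    set c : ℝ := (Real.sqrt S)⁻¹ with hc
    have hcS : c ^ 2 * S = 1 := by
      rw [hc, inv_pow, Real.sq_sqrt hSpos.le, inv_mul_cancel₀ hSpos.ne']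
    have h0 := hmem.inQM.eval_nonneg (x := Sum.elim x (c • y))
      (fun j => by simpa [liftIneq, eval_rename] using hg j) (by
        rintro (j | j)
        · simpa [liftEq, eval_rename] using hh j
        · simp [liftEq, mul_pow, ← Finset.mul_sum, ← hS, hcS])
    rw [map_sub, eval_C, eval_sjFormPoly, Sum.elim_comp_inl, Sum.elim_comp_inr,
      sjForm_smul] at h0
    by_contra! hcon
    nlinarith [mul_nonneg (sq_nonneg c) hcon]

end
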